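/- Let (X,d,μ) be a metric measure space with a doubling measure (doubling constant c_μ), let 1 < p < ∞ and let w ∈ A_p. Then there exists a constant C depending only on c_μ, p and [w]_{A_p} such that ∫_X (M*f)^p w dμ ≤ C ∫_X |f|^p w dμ for every f ∈ L^p(w dμ), where M* is the noncentered Hardy–Littlewood maximal function. -/

import Mathlib

open MeasureTheory Metric ENNReal

noncomputable section

/-- The standing assumptions on the metric measure space `(X, d, μ)`: `X` has at least two
points, `μ` is a positive complete Borel measure which is positive and finite on all open
balls, and `μ` is doubling with doubling constant `c > 1`. -/
def GoodSpace (X : Type*) [MetricSpace X] [MeasurableSpace X] (μ : Measure X) (c : ℝ) : Prop :=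
  Nontrivial X ∧ μ.IsComplete ∧
    (∀ (x : X) (r : ℝ), 0 < r → 0 < μ (ball x r) ∧ μ (ball x r) < ⊤) ∧
    1 < c ∧ ∀ (x : X) (r : ℝ), 0 < r → μ (ball x (2 * r)) ≤ ENNReal.ofReal c * μ (ball x r)

/-- `w` is a weight in `X`: measurable, positive `μ`-a.e., and integrable on all balls. -/
def IsWeight {X : Type*} [MetricSpace X] [MeasurableSpace X] (μ : Measure X) (w : X → ℝ) :
    Prop :=
  Measurable w ∧ (∀ᵐ x ∂μ, 0 < w x) ∧
    ∀ (x : X) (r : ℝ), 0 < r → IntegrableOn w (ball x r) μ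

/-- The weighted measure `w(E) = ∫_E w dμ` of a set `E`. -/
def wMeas {X : Type*} [MetricSpace X] [MeasurableSpace X] (μ : Measure X) (w : X → ℝ)
    (E : Set X) : ℝ≥0∞ :=
  ∫⁻ y in E, ENNReal.ofReal (w y) ∂μ

/-- The Muckenhoupt `A_p` condition with constant `C`:
`(⨍_B w dμ) * (⨍_B w^(1/(1-p)) dμ)^(p-1) ≤ C` for every ball `B`. -/
def ApWith {X : Type*} [MetricSpace X] [MeasurableSpace X] (μ : Measure X) (w : X → ℝ)
    (p C : ℝ) : Prop :=
  ∀ (x : X) (r : ℝ), 0 < r →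
    (wMeas μ w (ball x r) / μ (ball x r)) *
      ((∫⁻ y in ball x r, ENNReal.ofReal (w y) ^ (1 / (1 - p)) ∂μ) / μ (ball x r)) ^ (p - 1)
      ≤ ENNReal.ofReal C

/-- Membership in the Muckenhoupt class `A_p`. -/
def MemAp {X : Type*} [MetricSpace X] [MeasurableSpace X] (μ : Measure X) (w : X → ℝ)
    (p : ℝ) : Prop :=
  ∃ C : ℝ, ApWith μ w p C

/-- The smallest constant in the `A_p` condition, denoted `[w]_{A_p}`. -/
def ApConst {X : Type*} [MetricSpace X] [MeasurableSpace X] (μ : Measure X) (w : X → ℝ)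
    (p : ℝ) : ℝ :=
  sInf {C : ℝ | ApWith μ w p C}

/-- The noncentered maximal function of an `ℝ≥0∞`-valued function. -/
def MncE {X : Type*} [MetricSpace X] [MeasurableSpace X] (μ : Measure X) (g : X → ℝ≥0∞)
    (x : X) : ℝ≥0∞ :=
  ⨆ (z : X) (r : ℝ) (_ : x ∈ ball z r), (∫⁻ y in ball z r, g y ∂μ) / μ (ball z r)

/-- The noncentered Hardy–Littlewood maximal function `M* f`. -/
def Mnc {X : Type*} [MetricSpace X] [MeasurableSpace X] (μ : Measure X) (f : X → ℝ)
    (x : X) : ℝ≥0∞ :=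
  MncE μ (fun y => ENNReal.ofReal |f y|) x

/-- The weighted noncentered maximal function `M^{*,v} g` (for `ℝ≥0∞`-valued `g`). -/
def MncWE {X : Type*} [MetricSpace X] [MeasurableSpace X] (μ : Measure X) (v : X → ℝ)
    (g : X → ℝ≥0∞) (x : X) : ℝ≥0∞ :=
  ⨆ (z : X) (r : ℝ) (_ : x ∈ ball z r),
    (∫⁻ y in ball z r, g y * ENNReal.ofReal (v y) ∂μ) / wMeas μ v (ball z r)

/-- `f` has bounded support: `{x : f x ≠ 0}` is contained in some ball. -/
def BoundedSupport {X : Type*} [MetricSpace X] (f : X → ℝ) : Prop :=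
  ∃ (z : X) (r : ℝ), ∀ x, f x ≠ 0 → x ∈ ball z r

/-- Membership in the weighted space `L^p(w dμ)`. -/
def MemLpW {X : Type*} [MetricSpace X] [MeasurableSpace X] (μ : Measure X) (w : X → ℝ)
    (p : ℝ) (f : X → ℝ) : Prop :=
  Measurable f ∧ ∫⁻ x, ENNReal.ofReal |f x| ^ p * ENNReal.ofReal (w x) ∂μ < ⊤

/-- `w` is a doubling weight with constant `cw`:
`0 < w(B(x,2r)) ≤ cw · w(B(x,r)) < ∞` for all balls. -/
def DoublingWeight {X : Type*} [MetricSpace X] [MeasurableSpace X] (μ : Measure X)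
    (w : X → ℝ) (cw : ℝ) : Prop :=
  ∀ (x : X) (r : ℝ), 0 < r →
    0 < wMeas μ w (ball x (2 * r)) ∧
      wMeas μ w (ball x (2 * r)) ≤ ENNReal.ofReal cw * wMeas μ w (ball x r) ∧
      wMeas μ w (ball x r) < ⊤

lemma sigmaFinite_of_measure_ball_lt_top {X : Type*} [PseudoMetricSpace X] [MeasurableSpace X]
    {ν : Measure X} (hfin : ∀ (x : X) (r : ℝ), ν (ball x r) < ⊤) : SigmaFinite ν := by
  rcases isEmpty_or_nonempty X with hX | ⟨⟨x₀⟩⟩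
  · rw [Measure.eq_zero_of_isEmpty ν]
    infer_instance
  · exact ⟨⟨⟨fun n => ball x₀ n, fun _ => Set.mem_univ _, fun n => hfin x₀ n,
      iUnion_ball_nat x₀⟩⟩⟩

lemma lt_MncE_iff {X : Type*} [MetricSpace X] [MeasurableSpace X] {ν : Measure X}
    {g : X → ℝ≥0∞} {s : ℝ≥0∞} {x : X} :
    s < MncE ν g x ↔
      ∃ (z : X) (r : ℝ), x ∈ ball z r ∧ s < (∫⁻ y in ball z r, g y ∂ν) / ν (ball z r) := by
  simp only [MncE, lt_iSup_iff, exists_prop]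

lemma le_MncE {X : Type*} [MetricSpace X] [MeasurableSpace X] (ν : Measure X)
    (g : X → ℝ≥0∞) {x z : X} {r : ℝ} (hx : x ∈ ball z r) :
    (∫⁻ y in ball z r, g y ∂ν) / ν (ball z r) ≤ MncE ν g x :=
  le_iSup_of_le z (le_iSup_of_le r (le_iSup_of_le hx le_rfl))

lemma measurable_MncE {X : Type*} [MetricSpace X] [MeasurableSpace X] [OpensMeasurableSpace X]
    (ν : Measure X) (g : X → ℝ≥0∞) : Measurable (MncE ν g) := by
  refine measurable_of_Ioi fun s => IsOpen.measurableSet (isOpen_iff_forall_mem_open.2 ?_)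
  intro x hx
  obtain ⟨z, r, hxr, hs⟩ := lt_MncE_iff.1 hx
  exact ⟨ball z r, fun y hy => lt_MncE_iff.2 ⟨z, r, hy, hs⟩, isOpen_ball, hxr⟩

lemma MncE_le_add_const {X : Type*} [MetricSpace X] [MeasurableSpace X] (ν : Measure X)
    {g h : X → ℝ≥0∞} {s : ℝ≥0∞} (hgh : ∀ y, g y ≤ h y + s) (x : X) :
    MncE ν g x ≤ MncE ν h x + s := by
  refine iSup_le fun z => iSup_le fun r => iSup_le fun hx => ?_
  calc (∫⁻ y in ball z r, g y ∂ν) / ν (ball z r)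
      ≤ ((∫⁻ y in ball z r, h y ∂ν) + s * ν (ball z r)) / ν (ball z r) := by
        gcongr
        calc ∫⁻ y in ball z r, g y ∂ν ≤ ∫⁻ y in ball z r, (h y + s) ∂ν := lintegral_mono hgh
          _ = _ := by rw [lintegral_add_right _ measurable_const, setLIntegral_const]
    _ = (∫⁻ y in ball z r, h y ∂ν) / ν (ball z r) + s * ν (ball z r) / ν (ball z r) :=
        ENNReal.add_div
    _ ≤ MncE ν h x + s :=
        add_le_add (le_MncE ν h hx) (ENNReal.div_le_of_le_mul le_rfl)

/-- A measure is doubling with constant `D`: balls have positive finite measure and doubling the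
radius multiplies the measure by at most `D`. -/
structure IsDoublingWith {X : Type*} [MetricSpace X] [MeasurableSpace X] (ν : Measure X)
    (D : ℝ≥0∞) : Prop where
  pos : ∀ (x : X) (r : ℝ), 0 < r → 0 < ν (ball x r)
  lt_top : ∀ (x : X) (r : ℝ), ν (ball x r) < ⊤
  doubling : ∀ (x : X) (r : ℝ), 0 < r → ν (ball x (2 * r)) ≤ D * ν (ball x r)

lemma IsDoublingWith.ball_eight_mul_le {X : Type*} [MetricSpace X] [MeasurableSpace X]
    {ν : Measure X} {D : ℝ≥0∞} (hν : IsDoublingWith ν D) (x : X) {r : ℝ} (hr : 0 < r) :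
    ν (ball x (8 * r)) ≤ D ^ 3 * ν (ball x r) := by
  calc ν (ball x (8 * r)) = ν (ball x (2 * (2 * (2 * r)))) := by ring_nf
    _ ≤ D * (D * (D * ν (ball x r))) :=
        (hν.doubling x _ (by positivity)).trans <| mul_le_mul_right
          ((hν.doubling x _ (by positivity)).trans <| mul_le_mul_right (hν.doubling x _ hr) D) D
    _ = _ := by ring

/-- The weak type `(1, 1)` estimate for the maximal function. -/
lemma IsDoublingWith.mul_measure_lt_MncE_le {X : Type*} [MetricSpace X] [MeasurableSpace X]
    [OpensMeasurableSpace X] {ν : Measure X} {D : ℝ≥0∞} (hν : IsDoublingWith ν D)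
    (g : X → ℝ≥0∞) (s : ℝ≥0∞) :
    s * ν {x | s < MncE ν g x} ≤ D ^ 3 * ∫⁻ y, g y ∂ν := by
  have : SigmaFinite ν := sigmaFinite_of_measure_ball_lt_top hν.lt_top
  let T : ℕ → Set (X × ℝ) := fun n =>
    {a | a.2 ≤ n ∧ 0 < a.2 ∧ s < (∫⁻ y in ball a.1 a.2, g y ∂ν) / ν (ball a.1 a.2)}
  let E : ℕ → Set X := fun n => ⋃ a ∈ T n, ball a.1 a.2
  have hT : Monotone T := fun m n hmn a ha => ⟨ha.1.trans (by exact_mod_cast hmn), ha.2⟩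
  have hE : Monotone E := fun m n hmn => Set.biUnion_subset_biUnion_left (hT hmn)
  have hEq : {x | s < MncE ν g x} ⊆ ⋃ n, E n := by
    intro x hx
    obtain ⟨z, r, hxr, hs⟩ := lt_MncE_iff.1 hx
    obtain ⟨n, hn⟩ := exists_nat_ge r
    exact Set.mem_iUnion.2 ⟨n, Set.mem_biUnion (x := (z, r)) ⟨hn, pos_of_mem_ball hxr, hs⟩ hxr⟩
  have hbound : ∀ n, s * ν (E n) ≤ D ^ 3 * ∫⁻ y, g y ∂ν := by
    intro n
    obtain ⟨u, hu, hdisj, hcov⟩ := Vitali.exists_disjoint_subfamily_covering_enlargement_closedBall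
      (T n) Prod.fst Prod.snd n (fun a ha => ha.1) 4 (by norm_num)
    have hdisj' : u.PairwiseDisjoint fun a => ball a.1 a.2 :=
      hdisj.mono_on fun a _ => ball_subset_closedBall
    have hcount : u.Countable := by
      have h := Measure.countable_meas_pos_of_disjoint_iUnion (μ := ν)
        (As := fun a : u => ball a.1.1 a.1.2) (fun _ => isOpen_ball.measurableSet)
        (hdisj'.subtype _ _)
      rw [Set.eq_univ_of_forall (s := {i : u | 0 < ν (ball i.1.1 i.1.2)})
        fun a => hν.pos _ _ (hu a.2).2.1] at h
      exact Set.countable_coe_iff.1 (Set.countable_univ_iff.1 h)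
    have : Countable u := hcount.to_subtype
    have hsub : E n ⊆ ⋃ a : u, ball a.1.1 (8 * a.1.2) := by
      intro x hx
      obtain ⟨a, ha, hxa⟩ := Set.mem_iUnion₂.1 hx
      obtain ⟨b, hb, hab⟩ := hcov a ha
      refine Set.mem_iUnion.2 ⟨⟨b, hb⟩, ?_⟩
      exact closedBall_subset_ball (by linarith [(hu hb).2.1]) (hab (ball_subset_closedBall hxa))
    calc s * ν (E n) ≤ s * ∑' a : u, ν (ball a.1.1 (8 * a.1.2)) := by
          gcongr
          exact (measure_mono hsub).trans (measure_iUnion_le _)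
      _ = ∑' a : u, s * ν (ball a.1.1 (8 * a.1.2)) := ENNReal.tsum_mul_left.symm
      _ ≤ ∑' a : u, D ^ 3 * ∫⁻ y in ball a.1.1 a.1.2, g y ∂ν := by
          refine ENNReal.tsum_le_tsum fun a => ?_
          calc s * ν (ball a.1.1 (8 * a.1.2)) ≤ s * (D ^ 3 * ν (ball a.1.1 a.1.2)) := by
                gcongr
                exact hν.ball_eight_mul_le _ (hu a.2).2.1
            _ = D ^ 3 * (s * ν (ball a.1.1 a.1.2)) := by ring
            _ ≤ _ := by
                gcongr
                exact ENNReal.mul_le_of_le_div (hu a.2).2.2.le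
      _ = D ^ 3 * ∫⁻ y in ⋃ a ∈ u, ball a.1 a.2, g y ∂ν := by
          rw [ENNReal.tsum_mul_left, lintegral_biUnion hcount
            (fun _ _ => isOpen_ball.measurableSet) hdisj']
      _ ≤ _ := by
          gcongr
          exact Measure.restrict_le_self
  calc s * ν {x | s < MncE ν g x} ≤ s * ν (⋃ n, E n) := by gcongr
    _ = ⨆ n, s * ν (E n) := by rw [hE.measure_iUnion, ENNReal.mul_iSup]
    _ ≤ _ := iSup_le hbound

lemma lintegral_Ioi_indicator_rpow_ofReal {q : ℝ} (hq : 0 < q) {a : ℝ} (ha : 0 ≤ a) :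
    ∫⁻ t in Set.Ioi (0 : ℝ), {t : ℝ | ENNReal.ofReal t < ENNReal.ofReal a}.indicator
      (fun t => ENNReal.ofReal (t ^ (q - 1))) t = ENNReal.ofReal a ^ q / ENNReal.ofReal q := by
  have hmeas : MeasurableSet {t : ℝ | ENNReal.ofReal t < ENNReal.ofReal a} :=
    measurableSet_lt ENNReal.measurable_ofReal measurable_const
  have hset : {t : ℝ | ENNReal.ofReal t < ENNReal.ofReal a} ∩ Set.Ioi 0 = Set.Ioo 0 a := by
    ext t
    simp only [Set.mem_inter_iff, Set.mem_ofPred_eq, Set.mem_Ioi, Set.mem_Ioo]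
    constructor
    · rintro ⟨h, ht⟩
      exact ⟨ht, (ENNReal.ofReal_lt_ofReal_iff_of_nonneg ht.le).1 h⟩
    · rintro ⟨ht, h⟩
      exact ⟨(ENNReal.ofReal_lt_ofReal_iff_of_nonneg ht.le).2 h, ht⟩
  have hint : IntervalIntegrable (fun t : ℝ => t ^ (q - 1)) volume 0 a :=
    intervalIntegral.intervalIntegrable_rpow' (by linarith)
  rw [lintegral_indicator hmeas, Measure.restrict_restrict hmeas, hset,
    restrict_Ioo_eq_restrict_Ioc, ← ofReal_integral_eq_lintegral_ofReal]
  · rw [← intervalIntegral.integral_of_le ha, integral_rpow (Or.inl (by linarith)),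
      sub_add_cancel, Real.zero_rpow hq.ne', sub_zero, ENNReal.ofReal_div_of_pos hq,
      ENNReal.ofReal_rpow_of_nonneg ha hq.le]
  · exact (intervalIntegrable_iff_integrableOn_Ioc_of_le ha).1 hint
  · filter_upwards [ae_restrict_mem measurableSet_Ioc] with t ht
    exact Real.rpow_nonneg ht.1.le _

/-- The layer cake formula for a power of an extended nonnegative real. -/
lemma lintegral_Ioi_indicator_rpow {q : ℝ} (hq : 0 < q) (y : ℝ≥0∞) :
    ∫⁻ t in Set.Ioi (0 : ℝ), {t : ℝ | ENNReal.ofReal t < y}.indicator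
      (fun t => ENNReal.ofReal (t ^ (q - 1))) t = y ^ q / ENNReal.ofReal q := by
  rcases eq_or_ne y ⊤ with rfl | hy
  · rw [ENNReal.top_rpow_of_pos hq, ENNReal.top_div_of_ne_top ENNReal.ofReal_ne_top]
    refine ENNReal.eq_top_of_forall_nnreal_le fun r => ?_
    have hqr : (0 : ℝ) ≤ q * r := by positivity
    have h := lintegral_Ioi_indicator_rpow_ofReal hq (Real.rpow_nonneg hqr q⁻¹)
    rw [ENNReal.ofReal_rpow_of_nonneg (Real.rpow_nonneg hqr _) hq.le,
      Real.rpow_inv_rpow hqr hq.ne', ENNReal.ofReal_mul hq.le,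
      mul_comm (ENNReal.ofReal q), ENNReal.mul_div_cancel_right (by simpa using hq)
      ENNReal.ofReal_ne_top, ENNReal.ofReal_coe_nnreal] at h
    rw [← h]
    refine lintegral_mono fun t => Set.indicator_le_indicator_of_subset ?_ (fun _ => zero_le) t
    intro t _
    exact ENNReal.ofReal_lt_top
  · lift y to NNReal using hy
    simpa using lintegral_Ioi_indicator_rpow_ofReal hq y.coe_nonneg

/-- Integrated layer cake formula for extended nonnegative functions. -/
lemma lintegral_rpow_div_eq {X : Type*} [MeasurableSpace X] (ν : Measure X) [SFinite ν]
    {q : ℝ} (hq : 0 < q) {u v : X → ℝ≥0∞} (hu : Measurable u) (hv : Measurable v) :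
    ∫⁻ x, v x * (u x ^ q / ENNReal.ofReal q) ∂ν =
      ∫⁻ t in Set.Ioi (0 : ℝ), ENNReal.ofReal (t ^ (q - 1)) *
        ∫⁻ x in {x | ENNReal.ofReal t < u x}, v x ∂ν := by
  have hms : MeasurableSet {z : X × ℝ | ENNReal.ofReal z.2 < u z.1} :=
    measurableSet_lt (by fun_prop) (by fun_prop)
  have hmeas : Measurable (fun z : X × ℝ =>
      v z.1 * {z : X × ℝ | ENNReal.ofReal z.2 < u z.1}.indicator
        (fun z => ENNReal.ofReal (z.2 ^ (q - 1))) z) := by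
    refine (hv.comp measurable_fst).mul (Measurable.indicator ?_ hms)
    fun_prop
  calc ∫⁻ x, v x * (u x ^ q / ENNReal.ofReal q) ∂ν
      = ∫⁻ x, (∫⁻ t in Set.Ioi (0 : ℝ), v x *
          {z : X × ℝ | ENNReal.ofReal z.2 < u z.1}.indicator
            (fun z => ENNReal.ofReal (z.2 ^ (q - 1))) (x, t)) ∂ν := by
        refine lintegral_congr fun x => ?_
        rw [← lintegral_Ioi_indicator_rpow hq, ← lintegral_const_mul]
        · rfl
        · exact Measurable.indicator (by fun_prop) (measurableSet_lt (by fun_prop) (by fun_prop))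
    _ = ∫⁻ t in Set.Ioi (0 : ℝ), ∫⁻ x, v x *
          {z : X × ℝ | ENNReal.ofReal z.2 < u z.1}.indicator
            (fun z => ENNReal.ofReal (z.2 ^ (q - 1))) (x, t) ∂ν :=
        lintegral_lintegral_swap hmeas.aemeasurable
    _ = _ := by
        refine lintegral_congr fun t => ?_
        rw [← lintegral_const_mul _ hv, ← lintegral_indicator (measurableSet_lt (by fun_prop) hu)]
        refine lintegral_congr fun x => ?_
        by_cases h : ENNReal.ofReal t < u x <;> simp [Set.indicator, h, mul_comm]

/-- The constant of the strong type `(q, q)` estimate for the maximal function of a doubling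
measure with constant `D`. -/
def maximalConst (D : ℝ≥0∞) (q : ℝ) : ℝ≥0∞ :=
  ENNReal.ofReal q * (2 * D ^ 3) * (2 ^ (q - 1) / ENNReal.ofReal (q - 1))

lemma maximalConst_ne_top {D : ℝ≥0∞} (hD : D ≠ ⊤) {q : ℝ} (hq : 1 < q) :
    maximalConst D q ≠ ⊤ := by
  have hq1 : 0 < q - 1 := by linarith
  refine ENNReal.mul_ne_top (ENNReal.mul_ne_top ENNReal.ofReal_ne_top
    (ENNReal.mul_ne_top (by simp) (ENNReal.pow_ne_top hD))) (ENNReal.div_lt_top ?_ ?_).ne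
  · exact ENNReal.rpow_ne_top_of_nonneg hq1.le (by simp)
  · simpa using hq

/-- The strong type `(q, q)` estimate for the maximal function of a doubling measure. -/
lemma IsDoublingWith.lintegral_MncE_rpow_le {X : Type*} [MetricSpace X] [MeasurableSpace X]
    [OpensMeasurableSpace X] {ν : Measure X} {D : ℝ≥0∞} (hν : IsDoublingWith ν D)
    {q : ℝ} (hq : 1 < q) {g : X → ℝ≥0∞} (hg : Measurable g) :
    ∫⁻ x, MncE ν g x ^ q ∂ν ≤
      maximalConst D q * ∫⁻ x, g x ^ q ∂ν := by
  have : SigmaFinite ν := sigmaFinite_of_measure_ball_lt_top hν.lt_top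
  have hq0 : 0 < q := by linarith
  have hq1 : 0 < q - 1 := by linarith
  have hlevel : ∀ t : ℝ, 0 < t → ENNReal.ofReal t * ν {x | ENNReal.ofReal t < MncE ν g x} ≤
      (2 * D ^ 3) * ∫⁻ x in {x | ENNReal.ofReal t < 2 * g x}, g x ∂ν := by
    intro t ht
    have hms : MeasurableSet {x | ENNReal.ofReal t < 2 * g x} :=
      measurableSet_lt measurable_const (hg.const_mul 2)
    set h : X → ℝ≥0∞ := {x | ENNReal.ofReal t < 2 * g x}.indicator g with hh
    set s : ℝ≥0∞ := ENNReal.ofReal t / 2 with hs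
    have hs2 : ENNReal.ofReal t = s + s := (ENNReal.add_halves _).symm
    have hs_top : s ≠ ⊤ := (ENNReal.div_lt_top ENNReal.ofReal_ne_top two_ne_zero).ne
    have hgh : ∀ y, g y ≤ h y + s := by
      intro y
      by_cases hy : ENNReal.ofReal t < 2 * g y
      · simp [hh, hy]
      · simp only [hh, Set.indicator, Set.mem_ofPred_eq, hy, if_false, zero_add, hs]
        rw [ENNReal.le_div_iff_mul_le (by simp) (by simp), mul_comm]
        exact not_lt.1 hy
    have hsub : {x | ENNReal.ofReal t < MncE ν g x} ⊆ {x | s < MncE ν h x} := by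
      intro x hx
      have hx' : s + s < MncE ν h x + s :=
        hs2 ▸ lt_of_lt_of_le hx (MncE_le_add_const ν hgh x)
      exact (ENNReal.add_lt_add_iff_right hs_top).1 hx'
    calc ENNReal.ofReal t * ν {x | ENNReal.ofReal t < MncE ν g x}
        ≤ (s + s) * ν {x | s < MncE ν h x} := by rw [← hs2]; gcongr
      _ = 2 * (s * ν {x | s < MncE ν h x}) := by ring
      _ ≤ 2 * (D ^ 3 * ∫⁻ x, h x ∂ν) := by
          gcongr 2 * ?_
          exact hν.mul_measure_lt_MncE_le h s
      _ = _ := by rw [hh, lintegral_indicator hms, mul_assoc]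
  have hdiv : ∀ x, MncE ν g x ^ q =
      ENNReal.ofReal q * (1 * (MncE ν g x ^ q / ENNReal.ofReal q)) := fun x => by
    rw [one_mul, ENNReal.mul_div_cancel (by simpa using hq0) ENNReal.ofReal_ne_top]
  have hM := measurable_MncE ν g
  calc ∫⁻ x, MncE ν g x ^ q ∂ν
      = ENNReal.ofReal q * ∫⁻ t in Set.Ioi (0 : ℝ), ENNReal.ofReal (t ^ (q - 1)) *
          ν {x | ENNReal.ofReal t < MncE ν g x} := by
        rw [lintegral_congr hdiv, lintegral_const_mul _ (by fun_prop),
          lintegral_rpow_div_eq ν hq0 hM measurable_const]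
        simp
    _ ≤ ENNReal.ofReal q * ∫⁻ t in Set.Ioi (0 : ℝ), (2 * D ^ 3) *
          (ENNReal.ofReal (t ^ (q - 1 - 1)) *
            ∫⁻ x in {x | ENNReal.ofReal t < 2 * g x}, g x ∂ν) := by
        gcongr ENNReal.ofReal q * ?_
        refine setLIntegral_mono' measurableSet_Ioi fun t (ht : 0 < t) => ?_
        have ht' : t ^ (q - 1) = t ^ (q - 1 - 1) * t := by
          rw [Real.rpow_sub_one ht.ne' (q - 1), div_mul_cancel₀ _ ht.ne']
        rw [ht', ENNReal.ofReal_mul (Real.rpow_nonneg ht.le _), mul_assoc, mul_left_comm (2 * D ^ 3)]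
        exact mul_le_mul_right (hlevel t ht) _
    _ ≤ ENNReal.ofReal q * ((2 * D ^ 3) * ∫⁻ t in Set.Ioi (0 : ℝ),
          (ENNReal.ofReal (t ^ (q - 1 - 1)) *
            ∫⁻ x in {x | ENNReal.ofReal t < 2 * g x}, g x ∂ν)) := by
        gcongr ENNReal.ofReal q * ?_
        refine (lintegral_const_mul _ (Measurable.mul (by fun_prop) ?_)).le
        refine Antitone.measurable fun a b hab => ?_
        exact lintegral_mono_set fun x hx => (ENNReal.ofReal_le_ofReal hab).trans_lt hx
    _ = ENNReal.ofReal q * ((2 * D ^ 3) * ∫⁻ x, (2 ^ (q - 1) / ENNReal.ofReal (q - 1)) *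
          g x ^ q ∂ν) := by
        rw [← lintegral_rpow_div_eq ν hq1 (hg.const_mul 2) hg]
        congr 2
        refine lintegral_congr fun x => ?_
        have hgq : g x ^ q = g x ^ (q - 1) * g x := by
          conv_lhs => rw [← sub_add_cancel q 1]
          rw [ENNReal.rpow_add_of_nonneg _ _ hq1.le zero_le_one, ENNReal.rpow_one]
        rw [ENNReal.mul_rpow_of_nonneg _ _ hq1.le, hgq]
        simp only [div_eq_mul_inv]
        ring
    _ = _ := by
        rw [lintegral_const_mul _ (hg.pow_const q), maximalConst]
        ring

lemma lintegral_withDensity_eq_of_ae_mul_eq {X : Type*} [MeasurableSpace X] {μ : Measure X}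
    {V g h : X → ℝ≥0∞} (hV : Measurable V) (hg : Measurable g)
    (hgh : ∀ᵐ x ∂μ, V x * g x = h x) :
    ∫⁻ x, g x ∂(μ.withDensity V) = ∫⁻ x, h x ∂μ := by
  rw [lintegral_withDensity_eq_lintegral_mul _ hV hg]
  exact lintegral_congr_ae hgh

lemma setLIntegral_withDensity_eq_of_ae_mul_eq {X : Type*} [MeasurableSpace X] {μ : Measure X}
    {V g h : X → ℝ≥0∞} (hV : Measurable V) (hg : Measurable g)
    (hgh : ∀ᵐ x ∂μ, V x * g x = h x) {s : Set X} (hs : MeasurableSet s) :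
    ∫⁻ x in s, g x ∂(μ.withDensity V) = ∫⁻ x in s, h x ∂μ := by
  rw [restrict_withDensity hs]
  exact lintegral_withDensity_eq_of_ae_mul_eq hV hg (ae_restrict_of_ae hgh)

/-- The `A_p` condition for an extended nonnegative weight, together with the nondegeneracy and
local integrability of the weight. -/
structure IsApWeight {X : Type*} [MetricSpace X] [MeasurableSpace X] (μ : Measure X)
    (W : X → ℝ≥0∞) (p : ℝ) (K : ℝ≥0∞) : Prop where
  measurable : Measurable W
  ae_ne : ∀ᵐ x ∂μ, W x ≠ 0 ∧ W x ≠ ⊤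
  lt_top : ∀ (x : X) (r : ℝ), ∫⁻ y in ball x r, W y ∂μ < ⊤
  ap : ∀ (x : X) (r : ℝ), 0 < r →
    ((∫⁻ y in ball x r, W y ∂μ) / μ (ball x r)) *
      ((∫⁻ y in ball x r, W y ^ (1 / (1 - p)) ∂μ) / μ (ball x r)) ^ (p - 1) ≤ K

namespace IsApWeight

variable {X : Type*} [MetricSpace X] [MeasurableSpace X] {μ : Measure X} {W : X → ℝ≥0∞} {p : ℝ}
  {D K : ℝ≥0∞}

lemma measurable_dual (hW : IsApWeight μ W p K) : Measurable fun x => W x ^ (1 / (1 - p)) :=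
  hW.measurable.pow_const _

lemma dual_ae_ne (hW : IsApWeight μ W p K) :
    ∀ᵐ x ∂μ, W x ^ (1 / (1 - p)) ≠ 0 ∧ W x ^ (1 / (1 - p)) ≠ ⊤ := by
  filter_upwards [hW.ae_ne] with x hx
  exact ⟨(ENNReal.rpow_pos (pos_iff_ne_zero.2 hx.1) hx.2).ne',
    ENNReal.rpow_ne_top_of_ne_zero hx.1 hx.2⟩

lemma setLIntegral_ball_pos (hμ : IsDoublingWith μ D) {V : X → ℝ≥0∞} (hV : Measurable V)
    (hV0 : ∀ᵐ x ∂μ, V x ≠ 0 ∧ V x ≠ ⊤) (x : X) {r : ℝ} (hr : 0 < r) :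
    0 < ∫⁻ y in ball x r, V y ∂μ := by
  refine pos_iff_ne_zero.2 fun h => ?_
  rw [lintegral_eq_zero_iff hV] at h
  have h0 : ∀ᵐ y ∂μ.restrict (ball x r), False := by
    filter_upwards [h, ae_restrict_of_ae hV0] with y hy hy'
    exact hy'.1 hy
  rw [Filter.eventually_false_iff_eq_bot, ae_eq_bot, Measure.restrict_eq_zero] at h0
  exact (hμ.pos x r hr).ne' h0

lemma setLIntegral_mul_rpow_le (hμ : IsDoublingWith μ D) (hp : 1 < p)
    (hW : IsApWeight μ W p K) (x : X) {r : ℝ} (hr : 0 < r) :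
    (∫⁻ y in ball x r, W y ∂μ) * (∫⁻ y in ball x r, W y ^ (1 / (1 - p)) ∂μ) ^ (p - 1) ≤
      K * μ (ball x r) ^ p := by
  have hm0 := (hμ.pos x r hr).ne'
  have hmt := (hμ.lt_top x r).ne
  have h := hW.ap x r hr
  have hp1 : 0 < p - 1 := by linarith
  have hmp : μ (ball x r) ^ p = μ (ball x r) * μ (ball x r) ^ (p - 1) := by
    conv_lhs => rw [← add_sub_cancel 1 p, ENNReal.rpow_add _ _ hm0 hmt, ENNReal.rpow_one]
  rwa [ENNReal.div_rpow_of_nonneg _ _ hp1.le, ← ENNReal.mul_div_mul_comm (.inl hm0) (.inl hmt),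
    ← hmp, ENNReal.div_le_iff (ENNReal.rpow_pos (hμ.pos x r hr) hmt).ne'
      (ENNReal.rpow_ne_top_of_nonneg (by linarith) hmt)] at h

lemma dual_lt_top (hμ : IsDoublingWith μ D) (hp : 1 < p) (hK : K ≠ ⊤)
    (hW : IsApWeight μ W p K) (x : X) (r : ℝ) :
    ∫⁻ y in ball x r, W y ^ (1 / (1 - p)) ∂μ < ⊤ := by
  rcases le_or_gt r 0 with hr | hr
  · simp [ball_eq_empty.2 hr]
  have h := hW.setLIntegral_mul_rpow_le hμ hp x hr
  refine lt_top_iff_ne_top.2 fun htop => ?_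
  rw [htop, ENNReal.top_rpow_of_pos (by linarith),
    ENNReal.mul_top (setLIntegral_ball_pos hμ hW.measurable hW.ae_ne x hr).ne', top_le_iff] at h
  exact ENNReal.mul_ne_top hK
    (ENNReal.rpow_ne_top_of_nonneg (by linarith) (hμ.lt_top x r).ne) h

lemma measure_ball_rpow_le (hp : 1 < p) (hW : IsApWeight μ W p K) (x : X) (r : ℝ) :
    μ (ball x r) ^ p ≤ (∫⁻ y in ball x r, W y ∂μ) *
      (∫⁻ y in ball x r, W y ^ (1 / (1 - p)) ∂μ) ^ (p - 1) := by
  have hp0 : 0 < p := by linarith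
  have hp1 : p - 1 ≠ 0 := by linarith
  have hp1' : 1 - p ≠ 0 := by linarith
  have hpq := Real.HolderConjugate.conjExponent hp
  have hH := ENNReal.lintegral_mul_le_Lp_mul_Lq (μ.restrict (ball x r)) hpq
    (f := fun y => W y ^ (1 / p)) (g := fun y => W y ^ (-(1 / p)))
    (hW.measurable.pow_const _).aemeasurable (hW.measurable.pow_const _).aemeasurable
  have h1 : ∫⁻ y in ball x r, ((fun y => W y ^ (1 / p)) * fun y => W y ^ (-(1 / p))) y ∂μ =
      μ (ball x r) := by
    rw [← setLIntegral_one]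
    refine lintegral_congr_ae ?_
    filter_upwards [ae_restrict_of_ae hW.ae_ne] with y hy
    rw [Pi.mul_apply, ← ENNReal.rpow_add _ _ hy.1 hy.2, add_neg_cancel, ENNReal.rpow_zero]
  have h2 : ∀ y, (W y ^ (1 / p)) ^ p = W y := fun y => by
    rw [← ENNReal.rpow_mul, one_div_mul_cancel hp0.ne', ENNReal.rpow_one]
  have h3 : ∀ y, (W y ^ (-(1 / p))) ^ p.conjExponent = W y ^ (1 / (1 - p)) := fun y => by
    rw [← ENNReal.rpow_mul]
    congr 1
    rw [Real.conjExponent]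
    grind
  rw [h1] at hH
  simp only [h2, h3] at hH
  calc μ (ball x r) ^ p ≤ _ := ENNReal.rpow_le_rpow hH hp0.le
    _ = _ := by
      rw [ENNReal.mul_rpow_of_nonneg _ _ hp0.le, ← ENNReal.rpow_mul, ← ENNReal.rpow_mul,
        one_div_mul_cancel hp0.ne', ENNReal.rpow_one]
      congr 2
      rw [Real.conjExponent]
      field_simp

lemma doubling_aux (hμ : IsDoublingWith μ D) (hp : 1 < p) (hW : IsApWeight μ W p K)
    (x : X) {r : ℝ} (hr : 0 < r) :
    (∫⁻ y in ball x (2 * r), W y ∂μ) *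
        (∫⁻ y in ball x (2 * r), W y ^ (1 / (1 - p)) ∂μ) ^ (p - 1) ≤
      K * D ^ p * ((∫⁻ y in ball x r, W y ∂μ) *
        (∫⁻ y in ball x r, W y ^ (1 / (1 - p)) ∂μ) ^ (p - 1)) := by
  have hp0 : 0 ≤ p := by linarith
  calc _ ≤ K * μ (ball x (2 * r)) ^ p := hW.setLIntegral_mul_rpow_le hμ hp x (by positivity)
    _ ≤ K * (D * μ (ball x r)) ^ p := by
        gcongr
        exact hμ.doubling x r hr
    _ = K * D ^ p * μ (ball x r) ^ p := by
        rw [ENNReal.mul_rpow_of_nonneg _ _ hp0, mul_assoc]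
    _ ≤ _ := by
        gcongr
        exact hW.measure_ball_rpow_le hp x r

variable [OpensMeasurableSpace X]

/-- The measure with an `A_p` density is doubling. -/
lemma isDoublingWith (hμ : IsDoublingWith μ D) (hp : 1 < p) (hK : K ≠ ⊤)
    (hW : IsApWeight μ W p K) : IsDoublingWith (μ.withDensity W) (K * D ^ p) := by
  refine ⟨fun x r hr => ?_, fun x r => ?_, fun x r hr => ?_⟩
  all_goals simp only [withDensity_apply _ (isOpen_ball (α := X)).measurableSet]
  · exact setLIntegral_ball_pos hμ hW.measurable hW.ae_ne x hr
  · exact hW.lt_top x r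
  · have hp1 : 0 < p - 1 := by linarith
    have hs0 := setLIntegral_ball_pos hμ hW.measurable_dual hW.dual_ae_ne x
      (show 0 < 2 * r by positivity)
    have hst := hW.dual_lt_top hμ hp hK x (2 * r)
    have hmono : ∫⁻ y in ball x r, W y ^ (1 / (1 - p)) ∂μ ≤
        ∫⁻ y in ball x (2 * r), W y ^ (1 / (1 - p)) ∂μ :=
      lintegral_mono_set (ball_subset_ball (by linarith))
    refine (ENNReal.mul_le_mul_iff_left (ENNReal.rpow_pos hs0 hst.ne).ne'
      (ENNReal.rpow_ne_top_of_nonneg hp1.le hst.ne)).1 ?_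
    refine (hW.doubling_aux hμ hp x hr).trans ?_
    rw [mul_assoc (K * D ^ p)]
    gcongr

/-- The measure whose density is the dual weight of an `A_p` weight is doubling. -/
lemma isDoublingWith_dual (hμ : IsDoublingWith μ D) (hp : 1 < p) (hK : K ≠ ⊤)
    (hW : IsApWeight μ W p K) :
    IsDoublingWith (μ.withDensity fun x => W x ^ (1 / (1 - p)))
      ((K * D ^ p) ^ (1 / (p - 1))) := by
  refine ⟨fun x r hr => ?_, fun x r => ?_, fun x r hr => ?_⟩
  all_goals simp only [withDensity_apply _ (isOpen_ball (α := X)).measurableSet]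
  · exact setLIntegral_ball_pos hμ hW.measurable_dual hW.dual_ae_ne x hr
  · exact hW.dual_lt_top hμ hp hK x r
  · have hp1 : 0 < p - 1 := by linarith
    have hw0 := setLIntegral_ball_pos hμ hW.measurable hW.ae_ne x
      (show 0 < 2 * r by positivity)
    have hwt := hW.lt_top x (2 * r)
    have hmono : ∫⁻ y in ball x r, W y ∂μ ≤ ∫⁻ y in ball x (2 * r), W y ∂μ :=
      lintegral_mono_set (ball_subset_ball (by linarith))
    rw [← ENNReal.rpow_le_rpow_iff hp1, ENNReal.mul_rpow_of_nonneg _ _ hp1.le,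
      ← ENNReal.rpow_mul, one_div_mul_cancel hp1.ne', ENNReal.rpow_one]
    refine (ENNReal.mul_le_mul_iff_right hw0.ne' hwt.ne).1 ?_
    refine (hW.doubling_aux hμ hp x hr).trans ?_
    rw [mul_left_comm]
    gcongr

/-- Pointwise control of the maximal function by the composition of the weighted maximal functions
of the weight and of its dual weight. -/
lemma MncE_le (hμ : IsDoublingWith μ D) (hp : 1 < p) (hK : K ≠ ⊤) (hW : IsApWeight μ W p K)
    {F : X → ℝ≥0∞} (hF : Measurable F) (x : X) :
    MncE μ F x ≤ (K * MncE (μ.withDensity W) (fun y =>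
      MncE (μ.withDensity fun z => W z ^ (1 / (1 - p))) (fun z => F z / W z ^ (1 / (1 - p))) y
        ^ (p - 1) / W y) x) ^ (1 / (p - 1)) := by
  have hp1 : 0 < p - 1 := by linarith
  refine iSup_le fun z => iSup_le fun r => iSup_le fun hx => ?_
  have hr := pos_of_mem_ball hx
  have hB : MeasurableSet (ball z r) := isOpen_ball.measurableSet
  set h := MncE (μ.withDensity fun z => W z ^ (1 / (1 - p)))
    (fun z => F z / W z ^ (1 / (1 - p)))
  have hhm : Measurable h := measurable_MncE _ _
  have hle := le_MncE (μ.withDensity W) (fun y => h y ^ (p - 1) / W y) hx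
  have hm0 := (hμ.pos z r hr).ne'
  have hmt := (hμ.lt_top z r).ne
  have hA := hW.setLIntegral_mul_rpow_le hμ hp z hr
  have hw0 := (setLIntegral_ball_pos hμ hW.measurable hW.ae_ne z hr).ne'
  have hwt := (hW.lt_top z r).ne
  have hs0 := (setLIntegral_ball_pos hμ hW.measurable_dual hW.dual_ae_ne z hr).ne'
  have hst := (hW.dual_lt_top hμ hp hK z r).ne
  have hSint : ∫⁻ y in ball z r, F y / W y ^ (1 / (1 - p))
      ∂(μ.withDensity fun z => W z ^ (1 / (1 - p))) = ∫⁻ y in ball z r, F y ∂μ := by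
    refine setLIntegral_withDensity_eq_of_ae_mul_eq hW.measurable_dual
      (hF.div hW.measurable_dual) ?_ hB
    filter_upwards [hW.dual_ae_ne] with y hy
    exact ENNReal.mul_div_cancel hy.1 hy.2
  have hWint : ∫⁻ y in ball z r, h y ^ (p - 1) / W y ∂(μ.withDensity W) =
      ∫⁻ y in ball z r, h y ^ (p - 1) ∂μ := by
    refine setLIntegral_withDensity_eq_of_ae_mul_eq hW.measurable
      ((hhm.pow_const _).div hW.measurable) ?_ hB
    filter_upwards [hW.ae_ne] with y hy
    exact ENNReal.mul_div_cancel hy.1 hy.2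
  have hlow : ((∫⁻ y in ball z r, F y ∂μ) / ∫⁻ y in ball z r, W y ^ (1 / (1 - p)) ∂μ) ^ (p - 1) *
      μ (ball z r) ≤ ∫⁻ y in ball z r, h y ^ (p - 1) ∂μ := by
    rw [← setLIntegral_const]
    refine setLIntegral_mono' hB fun y hy => ENNReal.rpow_le_rpow ?_ hp1.le
    have := le_MncE (μ.withDensity fun z => W z ^ (1 / (1 - p)))
      (fun z => F z / W z ^ (1 / (1 - p))) hy
    rwa [hSint, withDensity_apply _ hB] at this
  rw [hWint, withDensity_apply _ hB] at hle
  rw [one_div, ENNReal.le_rpow_inv_iff hp1]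
  refine le_trans ?_ (mul_le_mul_right
    ((ENNReal.div_le_div_right hlow _).trans hle) K)
  set a := ∫⁻ y in ball z r, F y ∂μ
  set s := ∫⁻ y in ball z r, W y ^ (1 / (1 - p)) ∂μ
  set u := ∫⁻ y in ball z r, W y ∂μ
  set m := μ (ball z r)
  have hmp : m ^ p = m * m ^ (p - 1) := by
    conv_lhs => rw [← add_sub_cancel 1 p, ENNReal.rpow_add _ _ hm0 hmt, ENNReal.rpow_one]
  have hmp0 : m ^ (p - 1) ≠ 0 := (ENNReal.rpow_pos (pos_iff_ne_zero.2 hm0) hmt).ne'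
  have hmpt : m ^ (p - 1) ≠ ⊤ := ENNReal.rpow_ne_top_of_nonneg hp1.le hmt
  have hsp0 : s ^ (p - 1) ≠ 0 := (ENNReal.rpow_pos (pos_iff_ne_zero.2 hs0) hst).ne'
  have hspt : s ^ (p - 1) ≠ ⊤ := ENNReal.rpow_ne_top_of_nonneg hp1.le hst
  rw [ENNReal.div_rpow_of_nonneg _ _ hp1.le, ENNReal.div_rpow_of_nonneg _ _ hp1.le]
  rw [hmp] at hA
  have key : (m ^ (p - 1))⁻¹ ≤ K * m * (s ^ (p - 1))⁻¹ * u⁻¹ := by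
    rw [← div_eq_mul_inv, ← div_eq_mul_inv, ENNReal.le_div_iff_mul_le (.inl hw0) (.inl hwt),
      ENNReal.le_div_iff_mul_le (.inl hsp0) (.inl hspt), mul_assoc, mul_comm, ← div_eq_mul_inv,
      ENNReal.div_le_iff hmp0 hmpt, mul_assoc K]
    exact hA
  calc a ^ (p - 1) / m ^ (p - 1) ≤ a ^ (p - 1) * (K * m * (s ^ (p - 1))⁻¹ * u⁻¹) := by
        rw [div_eq_mul_inv]
        gcongr
    _ = _ := by
        simp only [div_eq_mul_inv]
        ring

/-- Muckenhoupt's theorem: an `A_p` weight makes the maximal function bounded on `L^p`. -/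
lemma lintegral_MncE_rpow_mul_le (hμ : IsDoublingWith μ D) (hp : 1 < p) (hK : K ≠ ⊤)
    (hW : IsApWeight μ W p K) {F : X → ℝ≥0∞} (hF : Measurable F) :
    ∫⁻ x, MncE μ F x ^ p * W x ∂μ ≤
      K ^ p.conjExponent *
        (maximalConst (K * D ^ p) p.conjExponent *
          maximalConst ((K * D ^ p) ^ (1 / (p - 1))) p) * ∫⁻ x, F x ^ p * W x ∂μ := by
  have hp0 : 0 < p := by linarith
  have hp1 : 0 < p - 1 := by linarith
  have hp1' : 1 - p ≠ 0 := by linarith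
  have hq : 1 < p.conjExponent := (Real.HolderConjugate.conjExponent hp).symm.lt
  have hq0 : 0 ≤ p.conjExponent := by linarith
  have hqp : (p - 1) * p.conjExponent = p := by
    rw [Real.conjExponent]; field_simp
  set S : X → ℝ≥0∞ := fun x => W x ^ (1 / (1 - p)) with hS
  have hSm : Measurable S := hW.measurable_dual
  set h := MncE (μ.withDensity S) (fun z => F z / S z)
  have hhm : Measurable h := measurable_MncE _ _
  set G := MncE (μ.withDensity W) (fun y => h y ^ (p - 1) / W y)
  have hGm : Measurable G := measurable_MncE _ _
  have hpt : ∀ x, MncE μ F x ^ p ≤ K ^ p.conjExponent * G x ^ p.conjExponent := fun x => by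
    refine (ENNReal.rpow_le_rpow (hW.MncE_le hμ hp hK hF x) hp0.le).trans_eq ?_
    rw [← ENNReal.rpow_mul, ← ENNReal.mul_rpow_of_nonneg _ _ hq0, Real.conjExponent,
      one_div_mul_eq_div]
  calc ∫⁻ x, MncE μ F x ^ p * W x ∂μ
      ≤ ∫⁻ x, K ^ p.conjExponent * (W x * G x ^ p.conjExponent) ∂μ := by
        refine lintegral_mono fun x => ?_
        rw [mul_left_comm, mul_comm]
        exact mul_le_mul_right (hpt x) _
    _ = K ^ p.conjExponent * ∫⁻ x, G x ^ p.conjExponent ∂(μ.withDensity W) := by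
        rw [lintegral_withDensity_eq_of_ae_mul_eq hW.measurable (hGm.pow_const _)
          (Filter.Eventually.of_forall fun _ => rfl)]
        exact lintegral_const_mul _ (hW.measurable.mul (hGm.pow_const _))
    _ ≤ K ^ p.conjExponent * (maximalConst (K * D ^ p) p.conjExponent *
          ∫⁻ x, (h x ^ (p - 1) / W x) ^ p.conjExponent ∂(μ.withDensity W)) := by
        gcongr
        exact (hW.isDoublingWith hμ hp hK).lintegral_MncE_rpow_le hq
          ((hhm.pow_const _).div hW.measurable)
    _ = K ^ p.conjExponent * (maximalConst (K * D ^ p) p.conjExponent *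
          ∫⁻ x, h x ^ p ∂(μ.withDensity S)) := by
        rw [lintegral_withDensity_eq_of_ae_mul_eq hSm (hhm.pow_const _)
          (Filter.Eventually.of_forall fun _ => rfl)]
        congr 2
        refine lintegral_withDensity_eq_of_ae_mul_eq hW.measurable
          (((hhm.pow_const _).div hW.measurable).pow_const _) ?_
        filter_upwards [hW.ae_ne] with x hx
        simp only [hS]
        rw [ENNReal.div_rpow_of_nonneg _ _ hq0, ← ENNReal.rpow_mul, hqp, div_eq_mul_inv,
          ← ENNReal.rpow_neg, mul_left_comm, mul_comm]
        congr 1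
        conv_lhs => rw [← ENNReal.rpow_one (W x)]
        rw [← ENNReal.rpow_mul, ← ENNReal.rpow_add _ _ hx.1 hx.2]
        congr 1
        rw [Real.conjExponent]
        grind
    _ ≤ K ^ p.conjExponent * (maximalConst (K * D ^ p) p.conjExponent *
          (maximalConst ((K * D ^ p) ^ (1 / (p - 1))) p *
            ∫⁻ x, (F x / S x) ^ p ∂(μ.withDensity S))) := by
        gcongr
        exact (hW.isDoublingWith_dual hμ hp hK).lintegral_MncE_rpow_le hp (hF.div hSm)
    _ = K ^ p.conjExponent * (maximalConst (K * D ^ p) p.conjExponent *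
          (maximalConst ((K * D ^ p) ^ (1 / (p - 1))) p * ∫⁻ x, F x ^ p * W x ∂μ)) := by
        congr 3
        refine lintegral_withDensity_eq_of_ae_mul_eq hSm ((hF.div hSm).pow_const _) ?_
        filter_upwards [hW.ae_ne] with x hx
        simp only [hS]
        rw [ENNReal.div_rpow_of_nonneg _ _ hp0.le, ← ENNReal.rpow_mul, div_eq_mul_inv (F x ^ p),
          ← ENNReal.rpow_neg, mul_left_comm, ← ENNReal.rpow_add _ _ hx.1 hx.2]
        congr 1
        conv_rhs => rw [← ENNReal.rpow_one (W x)]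
        congr 1
        grind
    _ = _ := by ring

end IsApWeight

/-- If `w ∈ A_p` with `[w]_{A_p} ≤ K`, then the noncentered maximal operator
is bounded on `L^p(w dμ)`, with a constant depending only on `c_μ`, `p` and `K`. -/
theorem stmt_7 (c p K : ℝ) (hc : 1 < c) (hp : 1 < p) (hK : 0 < K) :
    ∃ C : ℝ, 0 < C ∧
      ∀ (X : Type*) [MetricSpace X] [MeasurableSpace X] [OpensMeasurableSpace X]
        (μ : Measure X), GoodSpace X μ c →
        ∀ w : X → ℝ, IsWeight μ w → ApWith μ w p K →
          ∀ f : X → ℝ, MemLpW μ w p f →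
            ∫⁻ x, Mnc μ f x ^ p * ENNReal.ofReal (w x) ∂μ ≤
              ENNReal.ofReal C *
                ∫⁻ x, ENNReal.ofReal |f x| ^ p * ENNReal.ofReal (w x) ∂μ := by
  have hD : ENNReal.ofReal c ≠ ⊤ := ENNReal.ofReal_ne_top
  have hK' : ENNReal.ofReal K ≠ ⊤ := ENNReal.ofReal_ne_top
  have hp1 : 0 < p - 1 := by linarith
  have hq : 1 < p.conjExponent := (Real.HolderConjugate.conjExponent hp).symm.lt
  have hKD : ENNReal.ofReal K * ENNReal.ofReal c ^ p ≠ ⊤ :=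
    ENNReal.mul_ne_top hK' (ENNReal.rpow_ne_top_of_nonneg (by linarith) hD)
  set A : ℝ≥0∞ := ENNReal.ofReal K ^ p.conjExponent *
    (maximalConst (ENNReal.ofReal K * ENNReal.ofReal c ^ p) p.conjExponent *
      maximalConst ((ENNReal.ofReal K * ENNReal.ofReal c ^ p) ^ (1 / (p - 1))) p)
  have hA : A ≠ ⊤ := ENNReal.mul_ne_top (ENNReal.rpow_ne_top_of_nonneg (by linarith) hK')
    (ENNReal.mul_ne_top (maximalConst_ne_top hKD hq)
      (maximalConst_ne_top (ENNReal.rpow_ne_top_of_nonneg (by positivity) hKD) hp))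
  refine ⟨A.toReal + 1, by positivity, ?_⟩
  intro X _ _ _ μ hX w hw hAp f hf
  obtain ⟨-, -, hball, -, hdoub⟩ := hX
  have hμ : IsDoublingWith μ (ENNReal.ofReal c) := by
    refine ⟨fun x r hr => (hball x r hr).1, fun x r => ?_, hdoub⟩
    rcases le_or_gt r 0 with hr | hr
    · simp [ball_eq_empty.2 hr]
    · exact (hball x r hr).2
  have hW : IsApWeight μ (fun x => ENNReal.ofReal (w x)) p (ENNReal.ofReal K) := by
    refine ⟨hw.1.ennreal_ofReal, ?_, fun x r => ?_, hAp⟩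
    · filter_upwards [hw.2.1] with x hx
      exact ⟨(ENNReal.ofReal_pos.2 hx).ne', ENNReal.ofReal_ne_top⟩
    · rcases le_or_gt r 0 with hr | hr
      · simp [ball_eq_empty.2 hr]
      · exact (hw.2.2 x r hr).lintegral_lt_top
  refine (hW.lintegral_MncE_rpow_mul_le hμ hp hK' (F := fun y => ENNReal.ofReal |f y|)
    hf.1.abs.ennreal_ofReal).trans ?_
  refine mul_le_mul_left (show A ≤ _ from ?_) _
  conv_lhs => rw [← ENNReal.ofReal_toReal hA]
  exact ENNReal.ofReal_le_ofReal (by linarith)
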